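/- arXiv:2208.08536 — 3 statements merged into one kernel-verified Lean document; each statement's English description precedes it below -/
import Mathlib

section
/- There exists a constant M such that for every point p ∈ ℝ², the (Fréchet) derivative of f₁ at p has operator norm at most M; that is, the first derivative of f₁ is uniformly bounded on ℝ². -/
/-- The tumor reaction term of the glioblastoma–acidity model. -/
noncomputable def f₁ : ℝ × ℝ → ℝ :=
  fun p => p.1 * (1 - p.1) * (1 - p.2) / (1 + p.1 ^ 2 + p.2 ^ 2) ^ 2

lemma f₁_aux (u v : ℝ) :
    HasFDerivAt f₁
      ((((1 - 2*u)*(1-v)) / (1+u^2+v^2)^2 - 4*u*(u*(1-u)*(1-v))/(1+u^2+v^2)^3) •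
          ContinuousLinearMap.fst ℝ ℝ ℝ +
        ((-(u*(1-u))) / (1+u^2+v^2)^2 - 4*v*(u*(1-u)*(1-v))/(1+u^2+v^2)^3) •
          ContinuousLinearMap.snd ℝ ℝ ℝ) (u, v) := by
  have h1 : HasFDerivAt (fun p : ℝ × ℝ => p.1) (ContinuousLinearMap.fst ℝ ℝ ℝ) (u, v) :=
    hasFDerivAt_fst
  have h2 : HasFDerivAt (fun p : ℝ × ℝ => p.2) (ContinuousLinearMap.snd ℝ ℝ ℝ) (u, v) :=
    hasFDerivAt_snd
  have hD : (1+u^2+v^2) ≠ 0 := by positivity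
  have hN := (h1.mul (h1.const_sub 1)).mul (h2.const_sub 1)
  have hQ := (((h1.pow 2).const_add 1).add (h2.pow 2)).pow 2
  have hI := (hasDerivAt_inv (x := (1+u^2+v^2)^2) (pow_ne_zero 2 hD)).comp_hasFDerivAt (u, v) hQ
  have h := hN.mul hI
  have e : f₁ = fun p : ℝ × ℝ => p.1 * (1 - p.1) * (1 - p.2) * ((1 + p.1 ^ 2 + p.2 ^ 2) ^ 2)⁻¹ := by
    funext p; simp [f₁, div_eq_mul_inv]
  rw [e]
  refine HasFDerivAt.congr_fderiv h ?_
  ext <;> simp <;> field_simp <;> ring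

lemma f₁_bound (D X Y A B : ℝ) (hD : 1 ≤ D) (hX : |X| ≤ A * D) (hY : |Y| ≤ B * D^2) (hA : 0 ≤ A) :
    |X / D^2 - Y / D^3| ≤ A + B := by
  have hB : 0 ≤ B := by
    by_contra hB
    have := abs_nonneg Y
    have : 0 < D^2 := by positivity
    nlinarith
  have h1 : |X / D^2| ≤ A := by
    rw [abs_div, abs_of_pos (by positivity : 0 < D^2), div_le_iff₀ (by positivity)]
    nlinarith [mul_nonneg hA (by nlinarith : 0 ≤ D^2 - D)]
  have h2 : |Y / D^3| ≤ B := by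
    rw [abs_div, abs_of_pos (by positivity : 0 < D^3), div_le_iff₀ (by positivity)]
    have : 0 ≤ D^3 - D^2 := by nlinarith [mul_nonneg (sq_nonneg D) (by linarith : 0 ≤ D - 1)]
    nlinarith [mul_nonneg hB this]
  exact (abs_sub _ _).trans (add_le_add h1 h2)

/-- The first (Fréchet) derivative of `f₁` is uniformly bounded on `ℝ²`. -/
theorem f₁_fderiv_bounded : ∃ M : ℝ, ∀ p : ℝ × ℝ, ‖fderiv ℝ f₁ p‖ ≤ M := by
  refine ⟨(6 + 16) + (2 + 16), ?_⟩
  rintro ⟨u, v⟩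
  rw [(f₁_aux u v).fderiv]
  have hD : 1 ≤ 1+u^2+v^2 := by nlinarith [sq_nonneg u, sq_nonneg v]
  obtain ⟨s, hs0, hs⟩ : ∃ s : ℝ, 0 ≤ s ∧ 1+u^2+v^2 = s^2 :=
    ⟨√(1+u^2+v^2), Real.sqrt_nonneg _, (Real.sq_sqrt (by linarith)).symm⟩
  have hs1 : 1 ≤ s := by nlinarith
  have hu : |u| ≤ s := abs_le_of_sq_le_sq (by nlinarith [sq_nonneg v]) hs0
  have hv : |v| ≤ s := abs_le_of_sq_le_sq (by nlinarith [sq_nonneg u]) hs0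
  have hu1 : |1-u| ≤ 2*s := by rw [abs_le] at *; constructor <;> linarith
  have hv1 : |1-v| ≤ 2*s := by rw [abs_le] at *; constructor <;> linarith
  have hu2 : |1-2*u| ≤ 3*s := by rw [abs_le] at *; constructor <;> linarith
  have hN : |u*(1-u)*(1-v)| ≤ s*(2*s)*(2*s) := by
    rw [abs_mul, abs_mul]; gcongr
  rw [hs] at hD ⊢
  have b1 := f₁_bound (s^2) ((1 - 2*u)*(1-v)) (4*u*(u*(1-u)*(1-v))) 6 16 hD
    (by
      rw [abs_mul]
      calc _ ≤ (3*s)*(2*s) := by gcongr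
        _ = _ := by ring)
    (by
      rw [abs_mul, abs_mul, abs_of_pos (by norm_num : (0:ℝ) < 4)]
      calc _ ≤ 4*s*(s*(2*s)*(2*s)) := by gcongr
        _ = _ := by ring) (by norm_num)
  have b2 := f₁_bound (s^2) (-(u*(1-u))) (4*v*(u*(1-u)*(1-v))) 2 16 hD
    (by
      rw [abs_neg, abs_mul]
      calc _ ≤ s*(2*s) := by gcongr
        _ = _ := by ring)
    (by
      rw [abs_mul, abs_mul, abs_of_pos (by norm_num : (0:ℝ) < 4)]
      calc _ ≤ 4*s*(s*(2*s)*(2*s)) := by gcongr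
        _ = _ := by ring) (by norm_num)
  refine (norm_add_le _ _).trans (add_le_add ?_ ?_)
  · rw [norm_smul, Real.norm_eq_abs]
    exact (mul_le_of_le_one_right (abs_nonneg _) (ContinuousLinearMap.norm_fst_le ℝ ℝ ℝ)).trans b1
  · rw [norm_smul, Real.norm_eq_abs]
    exact (mul_le_of_le_one_right (abs_nonneg _) (ContinuousLinearMap.norm_snd_le ℝ ℝ ℝ)).trans b2
end

section
/- The function f₁ is globally Lipschitz continuous on ℝ²: there exists a nonnegative constant L such that |f₁(u₁,v₁) − f₁(u₂,v₂)| ≤ L · ‖(u₁,v₁) − (u₂,v₂)‖ for all (u₁,v₁), (u₂,v₂) ∈ ℝ². -/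
lemma aux_term {P Q d s t D : ℝ} (hP : |P| ≤ s) (hQ : |Q| ≤ t) (hd : |d| ≤ D) :
    |P * Q * d| ≤ s * t * D := by
  rw [abs_mul, abs_mul]
  have := abs_nonneg P
  have := abs_nonneg Q
  have := abs_nonneg d
  have hs : 0 ≤ s := by linarith
  have ht : 0 ≤ t := by linarith
  gcongr

lemma aux_div {a b s t K : ℝ} (hs : 0 < s) (ht : 0 < t)
    (h : |a * t - b * s| ≤ s * t * K) : |a / s - b / t| ≤ K := by
  have e : a / s - b / t = (a * t - b * s) / (s * t) := by
    field_simp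
  rw [e, abs_div, abs_of_pos (mul_pos hs ht), div_le_iff₀ (mul_pos hs ht)]
  linarith

/-- `f₁` is globally Lipschitz continuous on `ℝ²`. -/
theorem f₁_lipschitz :
    ∃ L : ℝ, 0 ≤ L ∧ ∀ p q : ℝ × ℝ, |f₁ p - f₁ q| ≤ L * ‖p - q‖ := by
  refine ⟨100, by norm_num, ?_⟩
  rintro ⟨u, v⟩ ⟨x, y⟩
  have hx : |u - x| ≤ ‖((u, v) : ℝ × ℝ) - (x, y)‖ := norm_fst_le (((u, v) : ℝ × ℝ) - (x, y))
  have hy : |v - y| ≤ ‖((u, v) : ℝ × ℝ) - (x, y)‖ := norm_snd_le (((u, v) : ℝ × ℝ) - (x, y))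
  generalize ‖((u, v) : ℝ × ℝ) - (x, y)‖ = D at hx hy ⊢
  have hD : 0 ≤ D := (abs_nonneg _).trans hx
  simp only [f₁]
  have bd : ∀ a b : ℝ, |1| ≤ 1 + a ^ 2 + b ^ 2 ∧ |a| ≤ 1 + a ^ 2 + b ^ 2 ∧
      |b| ≤ 1 + a ^ 2 + b ^ 2 ∧ |a * b| ≤ 1 + a ^ 2 + b ^ 2 ∧ |a ^ 2| ≤ 1 + a ^ 2 + b ^ 2 ∧
      |b ^ 2| ≤ 1 + a ^ 2 + b ^ 2 ∧ |(1 - a) * (1 - b)| ≤ 4 * (1 + a ^ 2 + b ^ 2) := by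
    intro a b
    refine ⟨?_, ?_, ?_, ?_, ?_, ?_, ?_⟩ <;> rw [abs_le] <;> constructor <;>
      nlinarith [sq_nonneg (a - 1), sq_nonneg (a + 1), sq_nonneg (b - 1), sq_nonneg (b + 1),
        sq_nonneg (a - b), sq_nonneg (a + b), sq_nonneg a, sq_nonneg b]
  obtain ⟨p1, p2, p3, p4, p5, p6, p7⟩ := bd u v
  obtain ⟨q1, q2, q3, q4, q5, q6, q7⟩ := bd x y
  have hs : 0 < 1 + u ^ 2 + v ^ 2 := by positivity
  have ht : 0 < 1 + x ^ 2 + y ^ 2 := by positivity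
  obtain ⟨s, es⟩ : ∃ s, s = 1 + u ^ 2 + v ^ 2 := ⟨_, rfl⟩
  obtain ⟨t, et⟩ : ∃ t, t = 1 + x ^ 2 + y ^ 2 := ⟨_, rfl⟩
  rw [← es] at p1 p2 p3 p4 p5 p6 p7 hs ⊢
  rw [← et] at q1 q2 q3 q4 q5 q6 q7 ht ⊢
  have h1 : |u / s - x / t| ≤ 5 * D := by
    apply aux_div hs ht
    -- u t - x s = (u - x) - u x (u - x) + ...
    have e : u * t - x * s = 1 * 1 * (u - x) - u * x * (u - x) + 1 * y ^ 2 * (u - x)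
        - v * x * (v - y) - 1 * (x * y) * (v - y) := by
      rw [es, et]; ring
    have := abs_le.1 (aux_term p1 q1 hx)
    have := abs_le.1 (aux_term p2 q2 hx)
    have := abs_le.1 (aux_term p1 q6 hx)
    have := abs_le.1 (aux_term p3 q2 hy)
    have := abs_le.1 (aux_term p1 q4 hy)
    rw [e, abs_le]; constructor <;> linarith
  have h2 : |(1 - u) * (1 - v) / s - (1 - x) * (1 - y) / t| ≤ 20 * D := by
    apply aux_div hs ht
    have e : (1 - u) * (1 - v) * t - (1 - x) * (1 - y) * s =
        -(1 * x * (u - x) + u * 1 * (u - x) + 1 * y * (v - y) + v * 1 * (v - y))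
        - (1 * 1 * (u - x) - u * x * (u - x) + 1 * y ^ 2 * (u - x)
            - v * x * (v - y) - 1 * (x * y) * (v - y))
        - (1 * 1 * (v - y) - v * y * (v - y) + 1 * x ^ 2 * (v - y)
            - u * y * (u - x) - 1 * (x * y) * (u - x))
        + (v * 1 * (u - x) + 1 * x * (v - y)
            + u ^ 2 * x * (v - y) - (u * v) * x * (u - x)
            + v ^ 2 * y * (u - x) - (u * v) * y * (v - y)) := by
      rw [es, et]; ring
    have := abs_le.1 (aux_term p1 q2 hx)
    have := abs_le.1 (aux_term p2 q1 hx)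
    have := abs_le.1 (aux_term p1 q3 hy)
    have := abs_le.1 (aux_term p3 q1 hy)
    have := abs_le.1 (aux_term p1 q1 hx)
    have := abs_le.1 (aux_term p2 q2 hx)
    have := abs_le.1 (aux_term p1 q6 hx)
    have := abs_le.1 (aux_term p3 q2 hy)
    have := abs_le.1 (aux_term p1 q4 hy)
    have := abs_le.1 (aux_term p1 q1 hy)
    have := abs_le.1 (aux_term p3 q3 hy)
    have := abs_le.1 (aux_term p1 q5 hy)
    have := abs_le.1 (aux_term p2 q3 hx)
    have := abs_le.1 (aux_term p1 q4 hx)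
    have := abs_le.1 (aux_term p3 q1 hx)
    have := abs_le.1 (aux_term p1 q2 hy)
    have := abs_le.1 (aux_term p5 q2 hy)
    have := abs_le.1 (aux_term p4 q2 hx)
    have := abs_le.1 (aux_term p6 q3 hx)
    have := abs_le.1 (aux_term p4 q3 hy)
    rw [e, abs_le]; constructor <;> linarith
  have b1 : |u / s| ≤ 1 := by
    rw [abs_div, abs_of_pos hs, div_le_one hs]; exact p2
  have b2 : |(1 - x) * (1 - y) / t| ≤ 4 := by
    rw [abs_div, abs_of_pos ht, div_le_iff₀ ht]; exact q7
  have e : u * (1 - u) * (1 - v) / s ^ 2 - x * (1 - x) * (1 - y) / t ^ 2 =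
      1 * (u / s) * ((1 - u) * (1 - v) / s - (1 - x) * (1 - y) / t)
      + 1 * ((1 - x) * (1 - y) / t) * (u / s - x / t) := by
    field_simp; ring
  rw [e]
  have i1 := aux_term (abs_one (α := ℝ)).le b1 h2
  have i2 := aux_term (abs_one (α := ℝ)).le b2 h1
  refine (abs_add_le _ _).trans ?_
  linarith
end

section
/- The function f₂ is globally Lipschitz continuous on ℝ²: there exists a nonnegative constant L such that |f₂(u₁,v₁) − f₂(u₂,v₂)| ≤ L · ‖(u₁,v₁) − (u₂,v₂)‖ for all (u₁,v₁), (u₂,v₂) ∈ ℝ². -/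
/-- The proton-efflux reaction term of the glioblastoma–acidity model. -/
noncomputable def f₂ : ℝ × ℝ → ℝ :=
  fun p => p.1 * p.2 / (1 + p.1 ^ 2 + p.2 ^ 2) ^ 2

lemma aux1 (c x y : ℝ) (hc : 1 ≤ c) : |x / (c + x^2) - y / (c + y^2)| ≤ |x - y| := by
  have h1 : 0 < c + x^2 := by positivity
  have h2 : 0 < c + y^2 := by positivity
  have e : x / (c + x^2) - y / (c + y^2) = (x - y) * ((c - x*y) / ((c + x^2) * (c + y^2))) := by
    field_simp
    ring
  rw [e, abs_mul]
  apply mul_le_of_le_one_right (abs_nonneg _)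
  rw [abs_div, abs_of_pos (mul_pos h1 h2), div_le_one (mul_pos h1 h2), abs_le]
  have h3 : 0 ≤ (c-1) * (c + x^2+y^2) := mul_nonneg (by linarith) (by positivity)
  constructor <;> nlinarith [sq_nonneg (x-y), sq_nonneg (x+y), sq_nonneg (x*y)]

lemma aux2 (v x y : ℝ) : |v / (1 + v^2 + x^2) - v / (1 + v^2 + y^2)| ≤ |x - y| := by
  have h1 : 0 < 1 + v^2 + x^2 := by positivity
  have h2 : 0 < 1 + v^2 + y^2 := by positivity
  have e : v / (1 + v^2 + x^2) - v / (1 + v^2 + y^2)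
      = (x - y) * (-(v * (x+y)) / ((1 + v^2 + x^2) * (1 + v^2 + y^2))) := by
    field_simp
    ring
  rw [e, abs_mul]
  apply mul_le_of_le_one_right (abs_nonneg _)
  rw [abs_div, abs_of_pos (mul_pos h1 h2), div_le_one (mul_pos h1 h2), abs_le]
  have : 0 ≤ v^2 * x^2 := by positivity
  have : 0 ≤ v^2 * y^2 := by positivity
  have : 0 ≤ x^2 * y^2 := by positivity
  have : 0 ≤ v^2 * v^2 := by positivity
  constructor <;> nlinarith [sq_nonneg (v-x), sq_nonneg (v+x), sq_nonneg (v-y), sq_nonneg (v+y)]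

lemma aux3 (x y z w : ℝ) :
    |x / (1 + y^2 + x^2) - z / (1 + w^2 + z^2)| ≤ |x - z| + |y - w| := by
  have h1 := aux1 (1 + y^2) x z (by nlinarith [sq_nonneg y])
  have h2 := aux2 z y w
  rw [show 1 + z^2 + y^2 = 1 + y^2 + z^2 by ring, show 1 + z^2 + w^2 = 1 + w^2 + z^2 by ring] at h2
  exact (abs_sub_le _ _ _).trans (add_le_add h1 h2)

lemma aux4 (x y : ℝ) : |x / (1 + y^2 + x^2)| ≤ 1 := by
  have h1 : 0 < 1 + y^2 + x^2 := by positivity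
  rw [abs_div, abs_of_pos h1, div_le_one h1, abs_le]
  constructor <;> nlinarith [sq_nonneg (x-1), sq_nonneg (x+1), sq_nonneg y]

lemma aux5 (p : ℝ × ℝ) : f₂ p = p.1 / (1 + p.2^2 + p.1^2) * (p.2 / (1 + p.1^2 + p.2^2)) := by
  unfold f₂
  rw [show 1 + p.2^2 + p.1^2 = 1 + p.1^2 + p.2^2 by ring, div_mul_div_comm, sq (1 + p.1^2 + p.2^2)]

/-- `f₂` is globally Lipschitz continuous on `ℝ²`. -/
theorem f₂_lipschitz :
    ∃ L : ℝ, 0 ≤ L ∧ ∀ p q : ℝ × ℝ, |f₂ p - f₂ q| ≤ L * ‖p - q‖ := by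
  refine ⟨4, by norm_num, fun p q => ?_⟩
  have hA : |p.1 - q.1| ≤ ‖p - q‖ := norm_fst_le (p - q)
  have hB : |p.2 - q.2| ≤ ‖p - q‖ := norm_snd_le (p - q)
  have h1 := aux3 p.1 p.2 q.1 q.2
  have h2 := aux3 p.2 p.1 q.2 q.1
  have h3 := aux4 p.1 p.2
  have h4 := aux4 q.2 q.1
  rw [aux5, aux5]
  generalize p.1 / (1 + p.2^2 + p.1^2) = a at *
  generalize p.2 / (1 + p.1^2 + p.2^2) = b at *
  generalize q.1 / (1 + q.2^2 + q.1^2) = c at *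
  generalize q.2 / (1 + q.1^2 + q.2^2) = d at *
  have e : a * b - c * d = a * (b - d) + d * (a - c) := by ring
  have h5 := abs_add_le (a * (b - d)) (d * (a - c))
  rw [abs_mul, abs_mul] at h5
  have h6 := mul_le_of_le_one_left (abs_nonneg (b - d)) h3
  have h7 := mul_le_of_le_one_left (abs_nonneg (a - c)) h4
  rw [e]
  linarith
end
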